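/- arXiv:1810.01090 — 2 statements merged into one kernel-verified Lean document; each statement's English description precedes it below -/
import Mathlib

section
/- Let (X₁,Y₁),…,(X_N,Y_N) be any points of 𝒳 × 𝒴 and let P_N g = (1/N) Σ_{i=1}^N g(X_i,Y_i). Let A > 0, set θ = 1/(2A), and let r > 0 be such that the local Bernstein condition holds at radius r: every f ∈ F with ‖f−f*‖_{L₂} = r satisfies ‖f−f*‖²_{L₂} ≤ A · P𝓛_f. If for every f ∈ F with ‖f−f*‖_{L₂} ≤ r one has |(P − P_N)𝓛_f| ≤ θ r² (where (P − P_N)𝓛_f = P𝓛_f − P_N𝓛_f), then every empirical risk minimizer f̂ ∈ argmin_{f∈F} P_N ℓ_f satisfies ‖f̂−f*‖_{L₂} ≤ r and P𝓛_{f̂} ≤ θ r². -/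
open MeasureTheory ProbabilityTheory Real

/-- deterministic risk bound for the ERM under a local Bernstein
condition and a uniform deviation bound on the localized class. -/
theorem erm_deterministic_bound
    {𝒳 : Type*} [MeasurableSpace 𝒳]
    (P : Measure (𝒳 × ℝ)) [IsProbabilityMeasure P]
    -- the convex class F
    (F : Set (𝒳 → ℝ))
    (hFconv : ∀ f ∈ F, ∀ g ∈ F, ∀ t : ℝ, 0 ≤ t → t ≤ 1 →
      (fun x => t * f x + (1 - t) * g x) ∈ F)
    -- the loss, convex and L-Lipschitz in its first argument
    (L : ℝ) (hL : 0 < L) (ℓ : ℝ → ℝ → ℝ)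
    (hconv : ∀ y : ℝ, ConvexOn ℝ Set.univ fun u => ℓ u y)
    (hlip : ∀ y : ℝ, LipschitzWith (Real.toNNReal L) fun u => ℓ u y)
    -- the oracle: unique risk minimizer over F
    (fstar : 𝒳 → ℝ) (hfstarF : fstar ∈ F)
    (hfstarMin : ∀ f ∈ F, (∫ z, ℓ (fstar z.1) z.2 ∂P) ≤ ∫ z, ℓ (f z.1) z.2 ∂P)
    (hfstarUnique : ∀ f ∈ F,
      (∫ z, ℓ (f z.1) z.2 ∂P) = (∫ z, ℓ (fstar z.1) z.2 ∂P) → f = fstar)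
    -- excess risk P𝓛_f and L₂(μ) norm, μ being the first marginal of P
    (PL : (𝒳 → ℝ) → ℝ)
    (hPL : ∀ f, PL f = ∫ z, (ℓ (f z.1) z.2 - ℓ (fstar z.1) z.2) ∂P)
    (norm2 : (𝒳 → ℝ) → ℝ)
    (hnorm2 : ∀ g : 𝒳 → ℝ, norm2 g = Real.sqrt (∫ x, g x ^ 2 ∂(P.map Prod.fst)))
    -- the data points and the empirical measure P_N
    (N : ℕ) (hN : 0 < N) (data : Fin N → 𝒳 × ℝ)
    -- constants and the local Bernstein condition at radius r
    (A : ℝ) (hA : 0 < A) (θ : ℝ) (hθ : θ = 1 / (2 * A))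
    (r : ℝ) (hr : 0 < r)
    (hBern : ∀ f ∈ F, norm2 (fun x => f x - fstar x) = r →
      (norm2 (fun x => f x - fstar x)) ^ 2 ≤ A * PL f)
    -- uniform deviations of (P - P_N)𝓛_f on the localized class
    (hdev : ∀ f ∈ F, norm2 (fun x => f x - fstar x) ≤ r →
      |PL f - (1 / N : ℝ) * ∑ i : Fin N,
          (ℓ (f (data i).1) (data i).2 - ℓ (fstar (data i).1) (data i).2)| ≤ θ * r ^ 2)
    -- an empirical risk minimizer
    (fhat : 𝒳 → ℝ) (hfhatF : fhat ∈ F)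
    (hERM : ∀ f ∈ F,
      (1 / N : ℝ) * ∑ i : Fin N, ℓ (fhat (data i).1) (data i).2
        ≤ (1 / N : ℝ) * ∑ i : Fin N, ℓ (f (data i).1) (data i).2) :
    norm2 (fun x => fhat x - fstar x) ≤ r ∧ PL fhat ≤ θ * r ^ 2 := by
  have hNpos : (0 : ℝ) ≤ 1 / N := by positivity
  have hemp : (1 / N : ℝ) * ∑ i : Fin N,
      (ℓ (fhat (data i).1) (data i).2 - ℓ (fstar (data i).1) (data i).2) ≤ 0 := by
    have h := hERM fstar hfstarF
    rw [Finset.sum_sub_distrib, mul_sub]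
    linarith
  have hle : norm2 (fun x => fhat x - fstar x) ≤ r := by
    by_contra hcon
    have hlt : r < norm2 (fun x => fhat x - fstar x) := lt_of_not_ge hcon
    obtain ⟨ρ, hρ⟩ : ∃ ρ, ρ = norm2 (fun x => fhat x - fstar x) := ⟨_, rfl⟩
    rw [← hρ] at hlt
    have hρ0 : 0 < ρ := hr.trans hlt
    obtain ⟨t, ht⟩ : ∃ t, t = r / ρ := ⟨_, rfl⟩
    have ht0 : 0 ≤ t := by rw [ht]; positivity
    have ht1 : t ≤ 1 := by rw [ht, div_le_one hρ0]; exact hlt.le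
    have hfF := hFconv fhat hfhatF fstar hfstarF t ht0 ht1
    have hnorm : norm2 (fun x => (fun x => t * fhat x + (1 - t) * fstar x) x - fstar x) = r := by
      have h1 : ∀ x, ((t * fhat x + (1 - t) * fstar x) - fstar x) ^ 2
          = t ^ 2 * (fhat x - fstar x) ^ 2 := fun x => by ring
      rw [hnorm2]
      simp only [h1]
      rw [integral_const_mul, Real.sqrt_mul (sq_nonneg t), Real.sqrt_sq ht0,
        ← hnorm2 (fun x => fhat x - fstar x), ← hρ, ht]
      field_simp
    have hB := hBern _ hfF hnorm
    have hD := (abs_le.mp (hdev _ hfF hnorm.le)).2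
    rw [hnorm] at hB
    have hsum : (1 / N : ℝ) * ∑ i : Fin N,
        (ℓ (t * fhat (data i).1 + (1 - t) * fstar (data i).1) (data i).2
          - ℓ (fstar (data i).1) (data i).2) ≤
        t * ((1 / N : ℝ) * ∑ i : Fin N,
        (ℓ (fhat (data i).1) (data i).2 - ℓ (fstar (data i).1) (data i).2)) := by
      rw [mul_left_comm, Finset.mul_sum (a := t)]
      refine mul_le_mul_of_nonneg_left (Finset.sum_le_sum fun i _ => ?_) hNpos
      have h := (hconv (data i).2).2 (Set.mem_univ (fhat (data i).1))
        (Set.mem_univ (fstar (data i).1)) ht0 (sub_nonneg.mpr ht1) (by ring)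
      simp only [smul_eq_mul] at h
      linarith
    have hneg := mul_nonpos_of_nonneg_of_nonpos ht0 hemp
    have hPLle : PL (fun x => t * fhat x + (1 - t) * fstar x) ≤ θ * r ^ 2 := by
      linarith
    have h2 := mul_le_mul_of_nonneg_left hPLle hA.le
    have h3 : A * (θ * r ^ 2) = r ^ 2 / 2 := by rw [hθ]; field_simp
    have h4 : 0 < r ^ 2 := by positivity
    linarith
  refine ⟨hle, ?_⟩
  have hD := (abs_le.mp (hdev _ hfhatF hle)).2
  linarith
end

section
/- Let A > 0, C > 0 and 0 < θ < 1/(2A), and assume the local Bernstein condition at radius √C: every f ∈ F with ‖f−f*‖²_{L₂} = C satisfies ‖f−f*‖²_{L₂} ≤ A · P𝓛_f. Then on the event Ω_K (defined in the context), every minmax MOM estimator f̂ ∈ argmin_{f∈F} sup_{g∈F} MOM_K(ℓ_f − ℓ_g) satisfies P𝓛_{f̂} ≤ 2θC. -/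
open MeasureTheory ProbabilityTheory Real

lemma exists_common_index {K : ℕ} (p q : Fin K → Prop) [DecidablePred p] [DecidablePred q]
    (hp : K < 2 * (Finset.univ.filter p).card) (hq : K ≤ 2 * (Finset.univ.filter q).card) :
    ∃ k, p k ∧ q k := by
  by_contra hcon
  push Not at hcon
  have hd : Disjoint (Finset.univ.filter p) (Finset.univ.filter q) := by
    rw [Finset.disjoint_filter]
    intro k _ hk
    exact hcon k hk
  have h1 := Finset.card_union_of_disjoint hd
  have h2 := Finset.card_le_univ (Finset.univ.filter p ∪ Finset.univ.filter q)
  rw [Fintype.card_fin] at h2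
  omega

/-- on the event Ω_K (more than K/2 blocks with deviations at
most θC for every f in the localized ball), under the local Bernstein
condition, any minmax MOM estimator has excess risk at most 2θC. -/
theorem mom_excess_risk_on_event
    {𝒳 : Type*} [MeasurableSpace 𝒳]
    (P : Measure (𝒳 × ℝ)) [IsProbabilityMeasure P]
    -- the convex class F
    (F : Set (𝒳 → ℝ))
    (hFconv : ∀ f ∈ F, ∀ g ∈ F, ∀ t : ℝ, 0 ≤ t → t ≤ 1 →
      (fun x => t * f x + (1 - t) * g x) ∈ F)
    -- the loss, convex and L-Lipschitz in its first argument
    (L : ℝ) (hL : 0 < L) (ℓ : ℝ → ℝ → ℝ)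
    (hconv : ∀ y : ℝ, ConvexOn ℝ Set.univ fun u => ℓ u y)
    (hlip : ∀ y : ℝ, LipschitzWith (Real.toNNReal L) fun u => ℓ u y)
    -- the oracle: unique risk minimizer over F
    (fstar : 𝒳 → ℝ) (hfstarF : fstar ∈ F)
    (hfstarMin : ∀ f ∈ F, (∫ z, ℓ (fstar z.1) z.2 ∂P) ≤ ∫ z, ℓ (f z.1) z.2 ∂P)
    (hfstarUnique : ∀ f ∈ F,
      (∫ z, ℓ (f z.1) z.2 ∂P) = (∫ z, ℓ (fstar z.1) z.2 ∂P) → f = fstar)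
    -- excess risk P𝓛_f and L₂(μ) norm, μ being the first marginal of P
    (PL : (𝒳 → ℝ) → ℝ)
    (hPL : ∀ f, PL f = ∫ z, (ℓ (f z.1) z.2 - ℓ (fstar z.1) z.2) ∂P)
    (norm2 : (𝒳 → ℝ) → ℝ)
    (hnorm2 : ∀ g : 𝒳 → ℝ, norm2 g = Real.sqrt (∫ x, g x ^ 2 ∂(P.map Prod.fst)))
    -- data points (a realization in the event Ω_K), blocks of equal size N/K
    (N K : ℕ) (hN : 0 < N) (hK : 0 < K) (hKdvd : K ∣ N)
    (data : Fin N → 𝒳 × ℝ)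
    (Bl : Fin K → Finset (Fin N))
    (hBlDisj : Set.PairwiseDisjoint Set.univ Bl)
    (hBlUnion : ∀ i : Fin N, ∃ k, i ∈ Bl k)
    (hBlCard : ∀ k, (Bl k).card = N / K)
    -- a median operator
    (med : ∀ m : ℕ, (Fin m → ℝ) → ℝ)
    (hmed : ∀ (m : ℕ) (v : Fin m → ℝ),
      m ≤ 2 * (Finset.univ.filter fun k => v k ≤ med m v).card ∧
      m ≤ 2 * (Finset.univ.filter fun k => med m v ≤ v k).card)
    -- constants, local Bernstein condition at radius √C
    (A C θ : ℝ) (hA : 0 < A) (hC : 0 < C) (hθ : 0 < θ) (hθA : θ < 1 / (2 * A))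
    (hBern : ∀ f ∈ F, (norm2 fun x => f x - fstar x) ^ 2 = C →
      (norm2 fun x => f x - fstar x) ^ 2 ≤ A * PL f)
    -- we are on the event Ω_K
    (hΩ : ∀ f ∈ F, (norm2 fun x => f x - fstar x) ^ 2 ≤ C →
      K < 2 * (Finset.univ.filter fun k : Fin K =>
        |(K / N : ℝ) * (∑ i ∈ Bl k,
            (ℓ (f (data i).1) (data i).2 - ℓ (fstar (data i).1) (data i).2)) - PL f|
          ≤ θ * C).card)
    -- a minmax MOM estimator
    (fhat : 𝒳 → ℝ) (hfhatF : fhat ∈ F)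
    (hfhatMin : ∀ f ∈ F,
      (⨆ g : F, med K (fun k => (K / N : ℝ) * ∑ i ∈ Bl k,
          (ℓ (fhat (data i).1) (data i).2 - ℓ ((g : 𝒳 → ℝ) (data i).1) (data i).2)))
      ≤ ⨆ g : F, med K (fun k => (K / N : ℝ) * ∑ i ∈ Bl k,
          (ℓ (f (data i).1) (data i).2 - ℓ ((g : 𝒳 → ℝ) (data i).1) (data i).2))) :
    PL fhat ≤ 2 * θ * C := by
  classical
  have hc0 : (0:ℝ) ≤ (K / N : ℝ) := by positivity
  have hθC : 0 < θ * C := mul_pos hθ hC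
  have hPL0 : ∀ g ∈ F, 0 ≤ PL g := by
    intro g hg
    rw [hPL]
    by_cases hd : Integrable (fun z : 𝒳 × ℝ => ℓ (g z.1) z.2 - ℓ (fstar z.1) z.2) P
    · by_cases hs : Integrable (fun z : 𝒳 × ℝ => ℓ (fstar z.1) z.2) P
      · have hgi : Integrable (fun z : 𝒳 × ℝ => ℓ (g z.1) z.2) P := by
          have := hd.add hs
          refine this.congr (Filter.Eventually.of_forall fun z => ?_)
          simp
        rw [integral_sub hgi hs]
        linarith [hfstarMin g hg]
      · have hgi : ¬ Integrable (fun z : 𝒳 × ℝ => ℓ (g z.1) z.2) P := by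
          intro hgi
          apply hs
          have := hgi.sub hd
          refine this.congr (Filter.Eventually.of_forall fun z => ?_)
          simp
        have : g = fstar := hfstarUnique g hg (by
          rw [integral_undef hgi, integral_undef hs])
        subst this
        simp
    · rw [integral_undef hd]
  obtain ⟨Q, hQ⟩ : ∃ Q : (𝒳 → ℝ) → Fin K → ℝ, ∀ g k, Q g k = (K / N : ℝ) * ∑ i ∈ Bl k,
      (ℓ (g (data i).1) (data i).2 - ℓ (fstar (data i).1) (data i).2) := ⟨_, fun _ _ => rfl⟩
  have hQsub : ∀ f g k, (K / N : ℝ) * ∑ i ∈ Bl k,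
      (ℓ (f (data i).1) (data i).2 - ℓ (g (data i).1) (data i).2) = Q f k - Q g k := by
    intro f g k
    rw [hQ, hQ, ← mul_sub, ← Finset.sum_sub_distrib]
    congr 1
    apply Finset.sum_congr rfl
    intro i _
    ring
  have hQs : ∀ k, Q fstar k = 0 := by
    intro k
    rw [hQ]
    simp
  simp only [hQsub] at hfhatMin
  simp only [← hQ] at hΩ
  have hfar : ∀ g ∈ F, C < (norm2 fun x => g x - fstar x) ^ 2 →
      K < 2 * (Finset.univ.filter fun k : Fin K => θ * C < Q g k).card := by
    intro g hg hgC
    set D := (norm2 fun x => g x - fstar x) ^ 2 with hD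
    have hD0 : 0 < D := hC.trans hgC
    set t := Real.sqrt (C / D) with ht
    have ht2 : t ^ 2 = C / D := Real.sq_sqrt (by positivity)
    have ht0 : 0 < t := Real.sqrt_pos.2 (by positivity)
    have ht1 : t ≤ 1 := by
      have h1 : C / D ≤ 1 := (div_le_one hD0).2 hgC.le
      nlinarith
    have hg' := hFconv g hg fstar hfstarF t ht0.le ht1
    set g' : 𝒳 → ℝ := fun x => t * g x + (1 - t) * fstar x with hg'd
    have hn : ∀ h : 𝒳 → ℝ, norm2 h ^ 2 = ∫ x, h x ^ 2 ∂(P.map Prod.fst) := by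
      intro h
      rw [hnorm2, Real.sq_sqrt]
      exact integral_nonneg fun x => sq_nonneg _
    have hg'C : (norm2 fun x => g' x - fstar x) ^ 2 = C := by
      rw [hn]
      have : (fun x => (g' x - fstar x) ^ 2) = fun x => t ^ 2 * (g x - fstar x) ^ 2 := by
        funext x
        simp only [hg'd]
        ring
      rw [this, integral_const_mul, ← hn fun x => g x - fstar x, ← hD, ht2]
      field_simp
    have hB := hBern g' hg' hg'C
    rw [hg'C] at hB
    have hPLg : 2 * (θ * C) < PL g' := by
      rw [lt_div_iff₀ (by positivity)] at hθA
      by_contra hcon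
      push Not at hcon
      have h1 := mul_le_mul_of_nonneg_left hcon hA.le
      nlinarith
    have hO := hΩ g' hg' hg'C.le
    refine hO.trans_le (Nat.mul_le_mul_left 2 (Finset.card_le_card ?_))
    apply Finset.monotone_filter_right
    intro k _ hk
    have hk1 := (abs_le.1 hk).1
    have hQt : Q g' k ≤ t * Q g k := by
      rw [hQ, hQ, mul_left_comm]
      apply mul_le_mul_of_nonneg_left _ hc0
      rw [Finset.mul_sum]
      apply Finset.sum_le_sum
      intro i _
      have := (hconv (data i).2).2 (Set.mem_univ (g (data i).1))
        (Set.mem_univ (fstar (data i).1)) ht0.le (sub_nonneg.2 ht1) (by ring)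
      simp only [smul_eq_mul] at this
      simp only [hg'd]
      linarith
    have h3 : θ * C < t * Q g k := by linarith
    have h4 : 0 < Q g k := by
      by_contra hcon
      push Not at hcon
      have := mul_nonpos_of_nonneg_of_nonpos ht0.le hcon
      linarith
    show θ * C < Q g k
    nlinarith
  have hlow : ∀ g ∈ F, K < 2 * (Finset.univ.filter fun k : Fin K => -(θ * C) ≤ Q g k).card := by
    intro g hg
    rcases le_or_gt ((norm2 fun x => g x - fstar x) ^ 2) C with h | h
    · refine (hΩ g hg h).trans_le (Nat.mul_le_mul_left 2 (Finset.card_le_card ?_))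
      apply Finset.monotone_filter_right
      intro k _ hk
      have hk1 := (abs_le.1 hk).1
      have := hPL0 g hg
      show -(θ * C) ≤ Q g k
      linarith
    · refine (hfar g hg h).trans_le (Nat.mul_le_mul_left 2 (Finset.card_le_card ?_))
      apply Finset.monotone_filter_right
      intro k _ hk
      have hk' : θ * C < Q g k := hk
      show -(θ * C) ≤ Q g k
      linarith
  have hstar : (⨆ g : F, med K (fun k => Q fstar k - Q g k)) ≤ θ * C := by
    haveI : Nonempty F := ⟨⟨fstar, hfstarF⟩⟩
    apply ciSup_le
    intro g
    obtain ⟨k, h1, h2⟩ := exists_common_index _ _ (hlow g g.2)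
      (hmed K (fun k => Q fstar k - Q g k)).2
    rw [hQs] at h2
    linarith
  have hbdd : BddAbove (Set.range fun g : F => med K (fun k => Q fhat k - Q g k)) := by
    refine ⟨(∑ k, |Q fhat k|) + θ * C, ?_⟩
    rintro _ ⟨g, rfl⟩
    obtain ⟨k, h1, h2⟩ := exists_common_index _ _ (hlow g g.2)
      (hmed K (fun k => Q fhat k - Q g k)).2
    have h3 := Finset.single_le_sum (f := fun k => |Q fhat k|) (fun k _ => abs_nonneg _)
      (Finset.mem_univ k)
    have h4 := le_abs_self (Q fhat k)
    simp only at h3 ⊢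
    linarith
  have hmain : med K (fun k => Q fhat k - Q fstar k) ≤ θ * C :=
    (le_ciSup hbdd ⟨fstar, hfstarF⟩).trans ((hfhatMin fstar hfstarF).trans hstar)
  have hm := (hmed K (fun k => Q fhat k - Q fstar k)).1
  rcases le_or_gt ((norm2 fun x => fhat x - fstar x) ^ 2) C with h | h
  · obtain ⟨k, h1, h2⟩ := exists_common_index _ _ (hΩ fhat hfhatF h) hm
    rw [hQs] at h2
    have := (abs_le.1 h1).1
    linarith
  · obtain ⟨k, h1, h2⟩ := exists_common_index _ _ (hfar fhat hfhatF h) hm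
    rw [hQs] at h2
    linarith
end
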